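/- Let f = G·(T_1 + T_2), where G, T_1, T_2 ∈ F[x_1,…,x_n] are products of linear forms, T_1 and T_2 are homogeneous of equal degree at most d (with d ≥ 1), T_1 and T_2 have no common linear factor (gcd(T_1,T_2) = 1), and the linear factors of T_1·T_2 span an F-subspace of dimension at least 5. Then there exists a set A of codimension-1 subspaces (hyperplanes through the origin) of F^n with |A| ≤ d^4 + d^6 such that every codimension-2 subspace W ∈ S(NonLin(f)) on which neither T_1 nor T_2 vanishes is contained in some V ∈ A. -/

import Mathlib

open MvPolynomial

/-- A linear form: a nonzero homogeneous degree-1 polynomial. -/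
def IsLinearForm {F : Type*} [Field F] {n : ℕ} (ℓ : MvPolynomial (Fin n) F) : Prop :=
  ℓ ≠ 0 ∧ ℓ.IsHomogeneous 1

/-- A product of linear forms (a nonzero scalar multiple of a product of linear forms). -/
def IsProdLinearForms {F : Type*} [Field F] {n : ℕ} (g : MvPolynomial (Fin n) F) : Prop :=
  ∃ (c : F) (L : Multiset (MvPolynomial (Fin n) F)),
    c ≠ 0 ∧ (∀ p ∈ L, IsLinearForm p) ∧ g = c • L.prod

/-- `g` has no linear factors. -/
def NoLinearFactor {F : Type*} [Field F] {n : ℕ} (g : MvPolynomial (Fin n) F) : Prop :=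
  ∀ ℓ : MvPolynomial (Fin n) F, IsLinearForm ℓ → ¬ ℓ ∣ g

/-- `h` is the non-linear part `NonLin(f)` of `f` (up to scalars): `h` has no linear
factors and `f` is a product of linear forms times `h`. -/
def IsNonLinPart {F : Type*} [Field F] {n : ℕ} (f h : MvPolynomial (Fin n) F) : Prop :=
  NoLinearFactor h ∧ ∃ L : MvPolynomial (Fin n) F, IsProdLinearForms L ∧ f = L * h

/-- `S(g)`: the set of codimension-2 subspaces `V(ℓ₁,ℓ₂)` of `F^n` on which `g`
vanishes, i.e. `g` belongs to the ideal generated by `ℓ₁, ℓ₂`. -/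
def vanishCodim2 {F : Type*} [Field F] {n : ℕ} (g : MvPolynomial (Fin n) F) :
    Set (Set (Fin n → F)) :=
  {W | ∃ ℓ₁ ℓ₂ : MvPolynomial (Fin n) F, IsLinearForm ℓ₁ ∧ IsLinearForm ℓ₂ ∧
    LinearIndependent F ![ℓ₁, ℓ₂] ∧
    W = {a : Fin n → F | eval a ℓ₁ = 0 ∧ eval a ℓ₂ = 0} ∧
    g ∈ Ideal.span {ℓ₁, ℓ₂}}


section LinearAlgebra

variable {K V : Type*} [Field K] [AddCommGroup V] [Module K V]

theorem Submodule.inf_eq_of_finrank_eq_two {P Y D : Submodule K V} (hP : Module.finrank K P = 2)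
    (hD : Module.finrank K D = 1) (hDP : D ≤ P) (hDY : D ≤ Y) (hPY : ¬ P ≤ Y) : P ⊓ Y = D := by
  have : FiniteDimensional K P := .of_finrank_pos (by omega)
  have hlt : Module.finrank K ↥(P ⊓ Y) < Module.finrank K P :=
    Submodule.finrank_lt_finrank_of_lt (inf_lt_left.2 hPY)
  exact (Submodule.eq_of_le_of_finrank_le (le_inf hDP hDY) (by omega)).symm

theorem Submodule.exists_line_le_of_planes {U : Submodule K V} (hU : Module.finrank K U = 2)
    {E : Set (Submodule K V)} (hE : ∀ P ∈ E, Module.finrank K P = 2)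
    (hUE : ∀ P ∈ E, Module.finrank K ↥(P ⊓ U) = 1)
    (hspan : ∀ S : Submodule K V, FiniteDimensional K S → (∀ P ∈ E, P ≤ S) → 5 ≤ Module.finrank K S) :
    (∃ P ∈ E, ∃ Q ∈ E, Module.finrank K ↥(P ⊓ Q) = 1 ∧ P ⊓ Q ≤ U) ∨
      ∃ P ∈ E, ∃ Q ∈ E, ∃ R ∈ E,
        Module.finrank K ↥(R ⊓ (P ⊔ Q)) = 1 ∧ R ⊓ (P ⊔ Q) ≤ U := by
  have hUfin : FiniteDimensional K U := .of_finrank_pos (by omega)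
  have hfin : ∀ P ∈ E, FiniteDimensional K P := fun P hP =>
    .of_finrank_pos (by rw [hE P hP]; omega)
  have hstep : ∀ S : Submodule K V, FiniteDimensional K S → U ≤ S → ∀ P ∈ E,
      Module.finrank K ↥(S ⊔ P) ≤ Module.finrank K S + 1 := by
    intro S _ hUS P hP
    have := hfin P hP
    have h1 := Submodule.finrank_sup_add_finrank_inf_eq S P
    have h2 : Module.finrank K ↥(P ⊓ U) ≤ Module.finrank K ↥(S ⊓ P) :=
      Submodule.finrank_mono (le_inf (inf_le_right.trans hUS) inf_le_left)
    have h3 := hUE P hP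
    have h4 := hE P hP
    omega
  have hout : ∀ S : Submodule K V, FiniteDimensional K S → Module.finrank K S < 5 →
      ∃ P ∈ E, ¬ P ≤ S := by
    intro S hS hlt
    by_contra! hcon
    exact absurd (hspan S hS hcon) (by omega)
  obtain ⟨P, hP, -⟩ := hout U hUfin (by omega)
  have := hfin P hP
  have hUP := hstep U hUfin le_rfl P hP
  obtain ⟨Q, hQ, hQP⟩ := hout (U ⊔ P) inferInstance (by omega)
  have := hfin Q hQ
  have hUPQ := hstep (U ⊔ P) inferInstance le_sup_left Q hQ
  obtain ⟨R, hR, hRPQ⟩ := hout (U ⊔ P ⊔ Q) inferInstance (by omega)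
  by_cases heq : P ⊓ U = Q ⊓ U
  · have hinf : Q ⊓ P = Q ⊓ U := Submodule.inf_eq_of_finrank_eq_two (hE Q hQ) (hUE Q hQ)
      inf_le_left (heq ▸ inf_le_left) fun hle => hQP (hle.trans le_sup_right)
    exact .inl ⟨Q, hQ, P, hP, hinf ▸ hUE Q hQ, hinf ▸ inf_le_right⟩
  · have hsup : (P ⊓ U) ⊔ (Q ⊓ U) = U := by
      refine Submodule.eq_of_le_of_finrank_le (sup_le inf_le_right inf_le_right) ?_
      have hlt : P ⊓ U < (P ⊓ U) ⊔ (Q ⊓ U) := by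
        refine left_lt_sup.2 fun hle => heq ?_
        exact (Submodule.eq_of_le_of_finrank_le hle (by rw [hUE P hP, hUE Q hQ])).symm
      have := Submodule.finrank_lt_finrank_of_lt hlt
      have := hUE P hP
      omega
    have hUle : U ≤ P ⊔ Q := by
      rw [← hsup]
      exact sup_le_sup inf_le_left inf_le_left
    have hinf : R ⊓ (P ⊔ Q) = R ⊓ U := Submodule.inf_eq_of_finrank_eq_two (hE R hR) (hUE R hR)
      inf_le_left (inf_le_right.trans hUle)
      fun hle => hRPQ (hle.trans (sup_le_sup_right le_sup_right Q))
    exact .inr ⟨P, hP, Q, hQ, R, hR, hinf ▸ hUE R hR, hinf ▸ inf_le_right⟩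

end LinearAlgebra
section LinearForms

variable {F : Type*} [Field F] {n : ℕ}

theorem IsLinearForm.prime {ℓ : MvPolynomial (Fin n) F} (hℓ : IsLinearForm ℓ) : Prime ℓ := by
  rw [← UniqueFactorizationMonoid.irreducible_iff_prime]
  refine irreducible_of_totalDegree_eq_one (hℓ.2.totalDegree hℓ.1) fun x hx => ?_
  obtain ⟨i, hi⟩ := ne_zero_iff.1 hℓ.1
  exact isUnit_iff_ne_zero.2 fun h0 => hi (zero_dvd_iff.1 (h0 ▸ hx i))

theorem IsLinearForm.exists_eq_smul_of_dvd {ℓ p : MvPolynomial (Fin n) F} (hℓ : IsLinearForm ℓ)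
    (hp : IsLinearForm p) (hdvd : ℓ ∣ p) : ∃ c : F, ℓ = c • p := by
  obtain ⟨u, hu⟩ := (hℓ.prime.dvd_prime_iff_associated hp.prime).1 hdvd
  have hC := totalDegree_eq_zero_iff_eq_C.1
    (isUnit_iff_totalDegree_of_isReduced.1 u⁻¹.isUnit).2
  refine ⟨coeff 0 (u⁻¹ : (MvPolynomial (Fin n) F)ˣ).1, ?_⟩
  rw [smul_eq_C_mul, ← hC, ← hu, mul_comm ℓ, Units.inv_mul_cancel_left]

theorem IsLinearForm.dvd_smul_prod_iff {ℓ : MvPolynomial (Fin n) F} (hℓ : IsLinearForm ℓ)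
    {c : F} (hc : c ≠ 0) {L : Multiset (MvPolynomial (Fin n) F)} :
    ℓ ∣ c • L.prod ↔ ∃ p ∈ L, ℓ ∣ p := by
  refine ⟨fun h => hℓ.prime.exists_mem_multiset_dvd ?_, ?_⟩
  · have := (h.mul_left (C c⁻¹))
    rwa [← smul_eq_C_mul, smul_smul, inv_mul_cancel₀ hc, one_smul] at this
  · rintro ⟨p, hp, hd⟩
    rw [smul_eq_C_mul]
    exact (hd.trans (Multiset.dvd_prod hp)).mul_left _

theorem IsProdLinearForms.exists_multiset_card_eq {T : MvPolynomial (Fin n) F} {m : ℕ}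
    (hT : IsProdLinearForms T) (hhom : T.IsHomogeneous m) :
    ∃ (c : F) (L : Multiset (MvPolynomial (Fin n) F)),
      c ≠ 0 ∧ (∀ p ∈ L, IsLinearForm p) ∧ T = c • L.prod ∧ L.card = m := by
  obtain ⟨c, L, hc, hL, rfl⟩ := hT
  refine ⟨c, L, hc, hL, rfl, ?_⟩
  have hprod : ∀ M : Multiset (MvPolynomial (Fin n) F), (∀ p ∈ M, IsLinearForm p) →
      M.prod ≠ 0 ∧ M.prod.IsHomogeneous M.card := by
    intro M
    induction M using Multiset.induction with
    | empty => exact fun _ => ⟨by simp, by simpa using isHomogeneous_one _ _⟩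
    | cons p M ih =>
      intro hM
      obtain ⟨h0, h1⟩ := ih fun q hq => hM q (Multiset.mem_cons_of_mem hq)
      obtain ⟨hp0, hp1⟩ := hM p (Multiset.mem_cons_self p M)
      rw [Multiset.prod_cons, Multiset.card_cons, add_comm]
      exact ⟨mul_ne_zero hp0 h0, hp1.mul h1⟩
  obtain ⟨h0, h1⟩ := hprod L hL
  have h2 : (c • L.prod).IsHomogeneous L.card := by
    rw [smul_eq_C_mul]
    exact h1.C_mul c
  exact h2.inj_right hhom (smul_ne_zero hc h0)

/-- An ideal generated by a space of linear forms is prime, tested on products of linear forms. -/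
theorem exists_mem_of_smul_prod_mem_ideal_span
    {S : Submodule F (MvPolynomial (Fin n) F)} (hS : ∀ p ∈ S, p.IsHomogeneous 1)
    {c : F} (hc : c ≠ 0) {L : Multiset (MvPolynomial (Fin n) F)}
    (hL : ∀ p ∈ L, IsLinearForm p)
    (hmem : c • L.prod ∈ Ideal.span (S : Set (MvPolynomial (Fin n) F))) : ∃ p ∈ L, p ∈ S := by
  obtain ⟨g, hg⟩ := S.mkQ.exists_rightInverse_of_surjective (Submodule.range_mkQ S)
  let π : MvPolynomial (Fin n) F →ₗ[F] MvPolynomial (Fin n) F := g ∘ₗ S.mkQ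
  have hπ : ∀ p, π p = 0 → p ∈ S := by
    intro p hp
    have h1 : S.mkQ (g (S.mkQ p)) = S.mkQ p := LinearMap.congr_fun hg (S.mkQ p)
    have h2 : g (S.mkQ p) = 0 := hp
    rw [h2, map_zero] at h1
    exact (Submodule.Quotient.mk_eq_zero S).1 h1.symm
  let φ : MvPolynomial (Fin n) F →ₐ[F] MvPolynomial (Fin n) F := aeval fun i => π (X i)
  have hφπ : ∀ p ∈ homogeneousSubmodule (Fin n) F 1, φ p = π p := by
    rw [homogeneousSubmodule_one_eq_span_X]
    intro p hp
    refine LinearMap.eqOn_span (f := φ.toLinearMap) (g := π) ?_ hp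
    rintro _ ⟨i, rfl⟩
    simp [φ]
  have hker : Ideal.span (S : Set (MvPolynomial (Fin n) F)) ≤ RingHom.ker φ := by
    refine Ideal.span_le.2 fun p hp => ?_
    have : S.mkQ p = 0 := (Submodule.Quotient.mk_eq_zero S).2 hp
    rw [SetLike.mem_coe, RingHom.mem_ker, hφπ p (hS p hp)]
    simp only [π, LinearMap.comp_apply, this, map_zero]
  have h0 : φ (c • L.prod) = 0 := hker hmem
  rw [map_smul, smul_eq_zero_iff_right hc, map_multiset_prod, Multiset.prod_eq_zero_iff,
    Multiset.mem_map] at h0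
  obtain ⟨p, hp, hp0⟩ := h0
  exact ⟨p, hp, hπ p ((hφπ p (hL p hp).2).symm.trans hp0)⟩

theorem IsNonLinPart.dvd_of_eq_mul {f h G T : MvPolynomial (Fin n) F} (hh : IsNonLinPart f h)
    (hG : IsProdLinearForms G) (hf : f = G * T) (h0 : h ≠ 0) : h ∣ T := by
  obtain ⟨hlin, L, -, hL⟩ := hh
  obtain ⟨c, M, hc, hM, rfl⟩ := hG
  refine UniqueFactorizationMonoid.dvd_of_dvd_mul_left_of_no_prime_factors h0 (c := c • M.prod)
    ?_ (by rw [mul_comm, ← hf, hL]; exact Dvd.intro_left L rfl)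
  intro q hqh hqM hq
  rw [smul_eq_C_mul] at hqM
  rcases hq.dvd_or_dvd hqM with hqc | hqM
  · exact hq.not_isUnit (isUnit_of_dvd_unit hqc ((isUnit_iff_ne_zero.2 hc).map C))
  · obtain ⟨p, hp, hqp⟩ := hq.exists_mem_multiset_dvd hqM
    have := (hq.dvd_prime_iff_associated (hM p hp).prime).1 hqp
    exact hlin p (hM p hp) (this.symm.dvd.trans hqh)

theorem finrank_span_pair_inf_eq_one {V : Type*} [AddCommGroup V] [Module F V]
    {U : Submodule F V} {a b : V} (hab : LinearIndependent F ![a, b]) (ha : a ∉ U)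
    (hb : b ∈ Submodule.span F {a} ⊔ U) :
    Module.finrank F ↥(Submodule.span F {a, b} ⊓ U) = 1 := by
  have h2 : Module.finrank F ↥(Submodule.span F {a, b}) = 2 := by
    have := finrank_span_eq_card hab
    rwa [Matrix.range_cons_cons_empty, Fintype.card_fin] at this
  have : FiniteDimensional F ↥(Submodule.span F {a, b}) := .of_finrank_pos (by omega)
  have hlt := Submodule.finrank_lt_finrank_of_lt (s := Submodule.span F {a, b} ⊓ U)
    (inf_lt_left.2 fun hle => ha (hle (Submodule.subset_span (by simp))))
  obtain ⟨_, hx, u, hu, hsum⟩ := Submodule.mem_sup.1 hb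
  obtain ⟨c, rfl⟩ := Submodule.mem_span_singleton.1 hx
  have hu0 : u ≠ 0 := by
    rintro rfl
    have := LinearIndependent.pair_iff.1 hab c (-1) (by rw [← hsum]; simp)
    simp at this
  have hne : Submodule.span F {a, b} ⊓ U ≠ ⊥ := by
    refine (Submodule.ne_bot_iff _).2 ⟨u, ⟨?_, hu⟩, hu0⟩
    rw [eq_sub_of_add_eq' hsum]
    exact sub_mem (Submodule.subset_span (by simp))
      (Submodule.smul_mem _ _ (Submodule.subset_span (by simp)))
  have := Submodule.one_le_finrank_iff.2 hne
  omega

/-- If `c • L.prod` and `T` cancel modulo the ideal of linear forms `ℓ₁, ℓ₂`, then each linear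
factor `a` of `T` agrees with some linear factor of the product, up to a scalar, modulo
`ℓ₁, ℓ₂`. -/
theorem exists_mem_span_sup_of_add_mem {T a ℓ₁ ℓ₂ : MvPolynomial (Fin n) F}
    (hℓ₁ : IsLinearForm ℓ₁) (hℓ₂ : IsLinearForm ℓ₂) (ha : IsLinearForm a) (haT : a ∣ T)
    {c : F} (hc : c ≠ 0) {L : Multiset (MvPolynomial (Fin n) F)}
    (hL : ∀ p ∈ L, IsLinearForm p) (hmem : T + c • L.prod ∈ Ideal.span {ℓ₁, ℓ₂}) :
    ∃ b ∈ L, b ∈ Submodule.span F {a} ⊔ Submodule.span F {ℓ₁, ℓ₂} := by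
  refine exists_mem_of_smul_prod_mem_ideal_span (fun p hp => ?_) hc hL ?_
  · have hle : Submodule.span F {a} ⊔ Submodule.span F {ℓ₁, ℓ₂} ≤
        homogeneousSubmodule (Fin n) F 1 := by
      refine sup_le (Submodule.span_le.2 ?_) (Submodule.span_le.2 ?_)
      · simpa using ha.2
      · simpa [Set.insert_subset_iff] using ⟨hℓ₁.2, hℓ₂.2⟩
    exact hle hp
  · rw [eq_sub_of_add_eq' (rfl : T + c • L.prod = _)]
    refine sub_mem (Ideal.span_mono ?_ hmem) (Ideal.mem_of_dvd _ haT (Ideal.subset_span ?_))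
    · exact Submodule.subset_span.trans (SetLike.coe_subset_coe.2 le_sup_right)
    · exact Submodule.mem_sup_left (Submodule.mem_span_singleton_self a)

end LinearForms

/-- Lemma: there is a set `A` of at most `d⁴ + d⁶` hyperplanes through the origin such
that every codimension-2 subspace `W ∈ S(NonLin(f))` on which neither `T₁` nor `T₂`
vanishes is contained in some `V ∈ A`. -/
theorem exists_hyperplane_cover
    {F : Type*} [Field F] [Fintype F] {n d m : ℕ}
    (G T₁ T₂ f h : MvPolynomial (Fin n) F)
    (hd : 1 ≤ d) (hmd : m ≤ d)
    (hG : IsProdLinearForms G) (hT₁ : IsProdLinearForms T₁) (hT₂ : IsProdLinearForms T₂)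
    (hT₁hom : T₁.IsHomogeneous m) (hT₂hom : T₂.IsHomogeneous m)
    (hgcd : ∀ ℓ : MvPolynomial (Fin n) F, IsLinearForm ℓ → ℓ ∣ T₁ → ¬ ℓ ∣ T₂)
    (hrank : 5 ≤ Module.finrank F
      ↥(Submodule.span F {ℓ : MvPolynomial (Fin n) F | IsLinearForm ℓ ∧ ℓ ∣ T₁ * T₂}))
    (hf : f = G * (T₁ + T₂)) (hh : IsNonLinPart f h) :
    ∃ A : Set (Set (Fin n → F)), A.ncard ≤ d ^ 4 + d ^ 6 ∧
      (∀ V ∈ A, ∃ ℓ : MvPolynomial (Fin n) F, IsLinearForm ℓ ∧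
        V = {a : Fin n → F | eval a ℓ = 0}) ∧
      (∀ W : Set (Fin n → F),
        (∃ ℓ₁ ℓ₂ : MvPolynomial (Fin n) F,
          IsLinearForm ℓ₁ ∧ IsLinearForm ℓ₂ ∧ LinearIndependent F ![ℓ₁, ℓ₂] ∧
          W = {a : Fin n → F | eval a ℓ₁ = 0 ∧ eval a ℓ₂ = 0} ∧
          h ∈ Ideal.span {ℓ₁, ℓ₂} ∧
          T₁ ∉ Ideal.span {ℓ₁, ℓ₂} ∧ T₂ ∉ Ideal.span {ℓ₁, ℓ₂}) →
        ∃ V ∈ A, W ⊆ V) := by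
  classical
  obtain ⟨c₁, L₁, hc₁, hL₁, hTL₁, hcard₁⟩ := hT₁.exists_multiset_card_eq hT₁hom
  obtain ⟨c₂, L₂, hc₂, hL₂, hTL₂, hcard₂⟩ := hT₂.exists_multiset_card_eq hT₂hom
  have hdvd₁ : ∀ a ∈ L₁, a ∣ T₁ := fun a ha =>
    hTL₁ ▸ ((hL₁ a ha).dvd_smul_prod_iff hc₁).2 ⟨a, ha, dvd_rfl⟩
  have hdvd₂ : ∀ b ∈ L₂, b ∣ T₂ := fun b hb =>
    hTL₂ ▸ ((hL₂ b hb).dvd_smul_prod_iff hc₂).2 ⟨b, hb, dvd_rfl⟩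
  have hindep : ∀ a ∈ L₁, ∀ b ∈ L₂, LinearIndependent F ![a, b] := by
    intro a ha b hb
    refine linearIndependent_fin2.2 ⟨(hL₂ b hb).1, fun c hc => ?_⟩
    have hc : c • b = a := hc
    refine hgcd b (hL₂ b hb) ?_ (hdvd₂ b hb)
    refine Dvd.dvd.trans ?_ (hdvd₁ a ha)
    rw [← hc, smul_eq_C_mul]
    exact Dvd.intro_left _ rfl
  let E : Finset (Submodule F (MvPolynomial (Fin n) F)) :=
    (L₁.toFinset ×ˢ L₂.toFinset).image fun p => Submodule.span F {p.1, p.2}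
  have hmemE : ∀ a ∈ L₁, ∀ b ∈ L₂, Submodule.span F {a, b} ∈ E := fun a ha b hb =>
    Finset.mem_image.2 ⟨(a, b), by simp [ha, hb], rfl⟩
  have hE : ∀ P ∈ E, Module.finrank F P = 2 ∧ P ≤ homogeneousSubmodule (Fin n) F 1 := by
    intro P hP
    obtain ⟨⟨a, b⟩, hab, rfl⟩ := Finset.mem_image.1 hP
    simp only [Finset.mem_product, Multiset.mem_toFinset] at hab
    constructor
    · have := finrank_span_eq_card (hindep a hab.1 b hab.2)
      rwa [Matrix.range_cons_cons_empty, Fintype.card_fin] at this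
    · refine Submodule.span_le.2 ?_
      simpa [Set.insert_subset_iff] using ⟨(hL₁ a hab.1).2, (hL₂ b hab.2).2⟩
  have hcardE : E.card ≤ d ^ 2 := by
    refine Finset.card_image_le.trans ?_
    rw [Finset.card_product, sq]
    exact Nat.mul_le_mul ((Multiset.toFinset_card_le L₁).trans (by omega))
      ((Multiset.toFinset_card_le L₂).trans (by omega))
  let lines : Finset (Submodule F (MvPolynomial (Fin n) F)) :=
    (E ×ˢ E).image (fun p => p.1 ⊓ p.2) ∪
      (E ×ˢ E ×ˢ E).image (fun p => p.1 ⊓ (p.2.1 ⊔ p.2.2))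
  have hlines : ∀ D ∈ lines, D ≤ homogeneousSubmodule (Fin n) F 1 := by
    intro D hD
    rcases Finset.mem_union.1 hD with hD | hD <;> obtain ⟨p, hp, rfl⟩ := Finset.mem_image.1 hD
    · exact inf_le_left.trans (hE _ (Finset.mem_product.1 hp).1).2
    · exact inf_le_left.trans (hE _ (Finset.mem_product.1 hp).1).2
  have hcard : lines.card ≤ d ^ 4 + d ^ 6 := by
    refine (Finset.card_union_le _ _).trans (add_le_add ?_ ?_) <;>
      refine Finset.card_image_le.trans ?_ <;> simp only [Finset.card_product]
    · exact (Nat.mul_le_mul hcardE hcardE).trans_eq (by ring)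
    · exact (Nat.mul_le_mul hcardE (Nat.mul_le_mul hcardE hcardE)).trans_eq (by ring)
  let zeros : Submodule F (MvPolynomial (Fin n) F) → Set (Fin n → F) :=
    fun D => {x | ∀ p ∈ D, eval x p = 0}
  let A : Finset (Set (Fin n → F)) :=
    (lines.filter fun D : Submodule F (MvPolynomial (Fin n) F) => Module.finrank F D = 1).image zeros
  refine ⟨A, ?_, ?_, ?_⟩
  · rw [Set.ncard_coe_finset]
    exact (Finset.card_image_le.trans (Finset.card_filter_le _ _)).trans hcard
  · intro V hV
    obtain ⟨D, hD, rfl⟩ := Finset.mem_image.1 (Finset.mem_coe.1 hV)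
    obtain ⟨hD, hD1⟩ := Finset.mem_filter.1 hD
    obtain ⟨⟨ℓ, hℓ⟩, hℓ0, hspan⟩ := finrank_eq_one_iff'.1 hD1
    refine ⟨ℓ, ⟨fun h0 => hℓ0 (Subtype.ext h0), hlines D hD hℓ⟩, ?_⟩
    ext x
    refine ⟨fun hx => hx ℓ hℓ, fun hx p hp => ?_⟩
    obtain ⟨c, hc⟩ := hspan ⟨p, hp⟩
    have hc : c • ℓ = p := congrArg Subtype.val hc
    have hx : eval x ℓ = 0 := hx
    rw [← hc, smul_eval, hx, mul_zero]
  · rintro W ⟨ℓ₁, ℓ₂, hℓ₁, hℓ₂, hℓ, rfl, hhI, hT₁I, hT₂I⟩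
    have hTI : T₁ + T₂ ∈ Ideal.span {ℓ₁, ℓ₂} := by
      refine Ideal.mem_of_dvd _ (hh.dvd_of_eq_mul hG hf ?_) hhI
      rintro rfl
      exact hh.1 ℓ₁ hℓ₁ (dvd_zero ℓ₁)
    let U : Submodule F (MvPolynomial (Fin n) F) := Submodule.span F {ℓ₁, ℓ₂}
    have hU : Module.finrank F U = 2 := by
      have := finrank_span_eq_card hℓ
      rwa [Matrix.range_cons_cons_empty, Fintype.card_fin] at this
    have hUI : ∀ p ∈ U, p ∈ Ideal.span {ℓ₁, ℓ₂} := fun p hp =>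
      Submodule.span_le_restrictScalars F (MvPolynomial (Fin n) F) _ hp
    have hfac₁ : ∀ a ∈ L₁, ∃ b ∈ L₂,
        Module.finrank F ↥(Submodule.span F {a, b} ⊓ U) = 1 := by
      intro a ha
      obtain ⟨b, hb, hbU⟩ := exists_mem_span_sup_of_add_mem hℓ₁ hℓ₂ (hL₁ a ha) (hdvd₁ a ha)
        hc₂ hL₂ (hTL₂ ▸ hTI)
      exact ⟨b, hb, finrank_span_pair_inf_eq_one (hindep a ha b hb)
        (fun haU => hT₁I (Ideal.mem_of_dvd _ (hdvd₁ a ha) (hUI a haU))) hbU⟩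
    have hfac₂ : ∀ b ∈ L₂, ∃ a ∈ L₁,
        Module.finrank F ↥(Submodule.span F {a, b} ⊓ U) = 1 := by
      intro b hb
      obtain ⟨a, ha, haU⟩ := exists_mem_span_sup_of_add_mem hℓ₁ hℓ₂ (hL₂ b hb) (hdvd₂ b hb)
        hc₁ hL₁ (hTL₁ ▸ add_comm T₁ T₂ ▸ hTI)
      refine ⟨a, ha, ?_⟩
      rw [Set.pair_comm]
      exact finrank_span_pair_inf_eq_one (LinearIndependent.pair_symm_iff.1 (hindep a ha b hb))
        (fun hbU => hT₂I (Ideal.mem_of_dvd _ (hdvd₂ b hb) (hUI b hbU))) haU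
    have hspan : ∀ S : Submodule F (MvPolynomial (Fin n) F), FiniteDimensional F S →
        (∀ P ∈ {P | P ∈ E ∧ Module.finrank F ↥(P ⊓ U) = 1}, P ≤ S) →
        5 ≤ Module.finrank F S := by
      intro S _ hS
      have hS₁ : ∀ a ∈ L₁, a ∈ S := fun a ha =>
        let ⟨b, hb, hab⟩ := hfac₁ a ha
        hS _ ⟨hmemE a ha b hb, hab⟩ (Submodule.subset_span (by simp))
      have hS₂ : ∀ b ∈ L₂, b ∈ S := fun b hb =>
        let ⟨a, ha, hab⟩ := hfac₂ b hb
        hS _ ⟨hmemE a ha b hb, hab⟩ (Submodule.subset_span (by simp))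
      refine hrank.trans (Submodule.finrank_mono (Submodule.span_le.2 ?_))
      rintro ℓ ⟨hℓ, hdvd⟩
      rcases hℓ.prime.dvd_or_dvd hdvd with hdvd | hdvd
      · obtain ⟨p, hp, hℓp⟩ := (hℓ.dvd_smul_prod_iff hc₁).1 (hTL₁ ▸ hdvd)
        obtain ⟨c, rfl⟩ := hℓ.exists_eq_smul_of_dvd (hL₁ p hp) hℓp
        exact S.smul_mem c (hS₁ p hp)
      · obtain ⟨p, hp, hℓp⟩ := (hℓ.dvd_smul_prod_iff hc₂).1 (hTL₂ ▸ hdvd)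
        obtain ⟨c, rfl⟩ := hℓ.exists_eq_smul_of_dvd (hL₂ p hp) hℓp
        exact S.smul_mem c (hS₂ p hp)
    have hline : ∃ D ∈ lines, Module.finrank F D = 1 ∧ D ≤ U := by
      rcases Submodule.exists_line_le_of_planes hU (fun P hP => (hE P hP.1).1)
        (fun P hP => hP.2) hspan with ⟨P, hP, Q, hQ, hD⟩ | ⟨P, hP, Q, hQ, R, hR, hD⟩
      · exact ⟨_, Finset.mem_union_left _ (Finset.mem_image.2
          ⟨(P, Q), Finset.mk_mem_product hP.1 hQ.1, rfl⟩), hD⟩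
      · exact ⟨_, Finset.mem_union_right _ (Finset.mem_image.2
          ⟨(R, P, Q), Finset.mk_mem_product hR.1 (Finset.mk_mem_product hP.1 hQ.1), rfl⟩), hD⟩
    obtain ⟨D, hD, hD1, hDU⟩ := hline
    refine ⟨zeros D, Finset.mem_coe.2 (Finset.mem_image_of_mem _
      (Finset.mem_filter.2 ⟨hD, hD1⟩)), ?_⟩
    rintro x ⟨hx₁, hx₂⟩ p hp
    obtain ⟨r, s, rfl⟩ := Submodule.mem_span_pair.1 (hDU hp)
    simp [smul_eval, hx₁, hx₂]
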